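/- Polynomial lower bound for logarithmic good area capture: For every ε, η > 0 there exist C = C(ε) > 0 and N₀ = N₀(ε, η) such that for any x, y ∈ ℕ² with a down-right path from x to y, with θ(x,y) ∈ [ε, π/2 − ε] and h := ‖x − y‖ ≥ N₀, the uniform measure P_{x,y} on down-right paths from x to y satisfies P_{x,y}[ |Enclose(γ ∩ A_{x,y})| − |T_{0,x,y}| ≥ η·h^{3/2}·(log h)^{1/2} ] ≥ h^{−C η²}. -/

import Mathlib

def IsStep (p q : ℤ × ℤ) : Prop := q = (p.1 + 1, p.2) ∨ q = (p.1, p.2 - 1)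

def IsPathFun (n : ℕ) (γ : ℕ → ℤ × ℤ) : Prop :=
  (∀ k, k < n → IsStep (γ k) (γ (k + 1))) ∧ ∀ k, n ≤ k → γ k = γ n

def IsLamPath (n : ℕ) (γ : ℕ → ℤ × ℤ) : Prop :=
  IsPathFun n γ ∧ (γ 0).1 = 0 ∧ (γ n).2 = 0 ∧ ∀ k, 0 ≤ (γ k).1 ∧ 0 ≤ (γ k).2

def IsPathBtw (n : ℕ) (x y : ℤ × ℤ) (γ : ℕ → ℤ × ℤ) : Prop :=
  IsPathFun n γ ∧ γ 0 = x ∧ γ n = y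

def pathArea (n : ℕ) (γ : ℕ → ℤ × ℤ) : ℤ :=
  ∑ k ∈ Finset.range n, if (γ (k + 1)).1 = (γ k).1 + 1 then (γ k).2 else 0

def cross (p q : ℤ × ℤ) : ℤ := p.1 * q.2 - p.2 * q.1

/-- Twice the excess area `|Enclose(γ ∩ A_{x,y})| − |T_{0,x,y}|` of a down-right path
from `x = γ 0` to `y = γ m`, computed by the shoelace formula. -/
def excessArea2 (m : ℕ) (γ : ℕ → ℤ × ℤ) : ℤ :=
  cross (γ 0) (γ m) - ∑ k ∈ Finset.range m, cross (γ k) (γ (k + 1))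

def stp (s : Bool) (x : ℤ × ℤ) : ℤ × ℤ := if s then (x.1 + 1, x.2) else (x.1, x.2 - 1)

def toPath : List Bool → ℤ × ℤ → ℕ → ℤ × ℤ
  | [], x, _ => x
  | _ :: _, x, 0 => x
  | s :: w, x, k + 1 => toPath w (stp s x) k

def endpt (w : List Bool) (x : ℤ × ℤ) : ℤ × ℤ :=
  (x.1 + (w.count true : ℤ), x.2 - (w.count false : ℤ))

def invc : List Bool → ℕ
  | [] => 0
  | s :: w => (if s then w.count false else 0) + invc w

lemma endpt_cons (s : Bool) (w : List Bool) (x : ℤ × ℤ) :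
    endpt (s :: w) x = endpt w (stp s x) := by
  cases s <;> simp [endpt, stp] <;> ring

lemma toPath_zero (w : List Bool) (x : ℤ × ℤ) : toPath w x 0 = x := by
  cases w <;> rfl

lemma toPath_ge (w : List Bool) : ∀ (x : ℤ × ℤ) (k : ℕ), w.length ≤ k →
    toPath w x k = endpt w x := by
  induction w with
  | nil => intro x k _; simp [toPath, endpt]
  | cons s w ih =>
    intro x k hk
    cases k with
    | zero => simp at hk
    | succ k =>
      rw [endpt_cons]
      exact ih _ k (by simpa using hk)

lemma toPath_step (w : List Bool) : ∀ (x : ℤ × ℤ) (k : ℕ), k < w.length →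
    IsStep (toPath w x k) (toPath w x (k + 1)) := by
  induction w with
  | nil => intro x k h; simp at h
  | cons s w ih =>
    intro x k hk
    cases k with
    | zero =>
      show IsStep x (toPath w (stp s x) 0)
      rw [toPath_zero]
      cases s <;> simp [IsStep, stp]
    | succ k => exact ih _ k (by simpa using hk)

lemma toPath_inj (w : List Bool) : ∀ (w' : List Bool) (x : ℤ × ℤ), w.length = w'.length →
    toPath w x = toPath w' x → w = w' := by
  induction w with
  | nil => intro w' x h _; simp at h; exact (List.length_eq_zero_iff.mp h.symm).symm
  | cons s w ih =>
    intro w' x hl h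
    cases w' with
    | nil => simp at hl
    | cons s' w' =>
      have h1 : ∀ k, toPath w (stp s x) k = toPath w' (stp s' x) k := fun k => congrFun h (k + 1)
      have h2 := h1 0
      rw [toPath_zero, toPath_zero] at h2
      have hs : s = s' := by
        cases s <;> cases s' <;> simp [stp, Prod.ext_iff] at h2 ⊢
      subst hs
      rw [ih w' (stp s x) (by simpa using hl) (funext h1)]

lemma exists_word (n : ℕ) : ∀ γ : ℕ → ℤ × ℤ, IsPathFun n γ →
    ∃ w : List Bool, w.length = n ∧ γ = toPath w (γ 0) := by
  induction n with
  | zero =>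
    intro γ h
    exact ⟨[], rfl, funext fun k => h.2 k (Nat.zero_le _)⟩
  | succ n ih =>
    intro γ h
    obtain ⟨w, hw, hg⟩ := ih (fun k => γ (k + 1))
      ⟨fun k hk => h.1 (k + 1) (by omega), fun k hk => h.2 (k + 1) (by omega)⟩
    have h0 := h.1 0 (by omega)
    have : ∃ s, γ (0 + 1) = stp s (γ 0) := by
      rcases h0 with h0 | h0
      · exact ⟨true, by simpa [stp] using h0⟩
      · exact ⟨false, by simpa [stp] using h0⟩
    obtain ⟨s, hs⟩ := this
    refine ⟨s :: w, by simp [hw], ?_⟩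
    funext k
    cases k with
    | zero => rfl
    | succ k =>
      have := congrFun hg k
      rw [this, hs]; rfl

lemma count_tf (w : List Bool) : w.count true + w.count false = w.length := by
  induction w with
  | nil => rfl
  | cons s w ih => cases s <;> simp <;> omega

lemma area_word (w : List Bool) : ∀ x : ℤ × ℤ,
    ∑ k ∈ Finset.range w.length, cross (toPath w x k) (toPath w x (k + 1))
      = cross x (endpt w x) - (2 * (invc w : ℤ) - (w.count true : ℤ) * (w.count false : ℤ)) := by
  induction w with
  | nil => intro x; simp [cross, endpt, invc]; ring
  | cons s w ih =>
    intro x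
    rw [List.length_cons, Finset.sum_range_succ']
    have : ∀ k, toPath (s :: w) x (k + 1) = toPath w (stp s x) k := fun k => rfl
    simp only [this, ih, toPath_zero]
    cases s <;> simp [cross, endpt, invc, stp] <;> ring

lemma excess_word (w : List Bool) (x : ℤ × ℤ) :
    excessArea2 w.length (toPath w x)
      = 2 * (invc w : ℤ) - (w.count true : ℤ) * (w.count false : ℤ) := by
  rw [excessArea2, area_word, toPath_zero, toPath_ge w x _ le_rfl]; ring

def words : ℕ → ℕ → Finset (List Bool)
  | 0, 0 => {[]}
  | a + 1, 0 => (words a 0).image (List.cons true)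
  | 0, b + 1 => (words 0 b).image (List.cons false)
  | a + 1, b + 1 => (words a (b + 1)).image (List.cons true) ∪
      (words (a + 1) b).image (List.cons false)

lemma mem_words (w : List Bool) : ∀ a b, w ∈ words a b ↔ w.count true = a ∧ w.count false = b := by
  induction w with
  | nil =>
    intro a b
    cases a <;> cases b <;> simp [words]
  | cons s w ih =>
    intro a b
    cases a <;> cases b <;> cases s <;> simp [words, ih]

lemma card_words (a b : ℕ) : (words a b).card = (a + b).choose a := by
  induction a, b using words.induct with
  | case1 => simp [words]
  | case2 a ih =>
    rw [words, Finset.card_image_of_injective _ List.cons_injective, ih]; simp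
  | case3 b ih =>
    rw [words, Finset.card_image_of_injective _ List.cons_injective, ih]; simp
  | case4 a b ih1 ih2 =>
    rw [words, Finset.card_union_of_disjoint, Finset.card_image_of_injective _ List.cons_injective,
      Finset.card_image_of_injective _ List.cons_injective, ih1, ih2]
    · rw [show a + 1 + (b + 1) = (a + b + 1) + 1 by ring, Nat.choose_succ_succ]
      congr 2; ring
    · rw [Finset.disjoint_left]
      intro w h1 h2
      simp only [Finset.mem_image] at h1 h2
      obtain ⟨u, _, rfl⟩ := h1
      obtain ⟨v, _, h⟩ := h2
      simp at h

lemma invc_append (u v : List Bool) :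
    invc (u ++ v) = invc u + invc v + u.count true * v.count false := by
  induction u with
  | nil => simp [invc]
  | cons s u ih => cases s <;> simp [invc, ih] <;> ring

lemma invc_reverse (u : List Bool) :
    invc u + invc u.reverse = u.count true * u.count false := by
  induction u with
  | nil => simp [invc]
  | cons s u ih =>
    rw [List.reverse_cons, invc_append]
    cases s <;> simp [invc] <;> nlinarith

def halfW (a b : ℕ) : Finset (List Bool) := (words a b).filter fun w => a * b ≤ 2 * invc w

lemma card_halfW (a b : ℕ) : (a + b).choose a ≤ 2 * (halfW a b).card := by
  rw [← card_words, halfW,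
    ← Finset.card_filter_add_card_filter_not (s := words a b) (fun w => a * b ≤ 2 * invc w)]
  have : ((words a b).filter fun w => ¬ a * b ≤ 2 * invc w).card ≤
      ((words a b).filter fun w => a * b ≤ 2 * invc w).card := by
    apply Finset.card_le_card_of_injOn List.reverse
    · intro w hw
      simp only [Finset.coe_filter, Set.mem_ofPred_eq, mem_words, List.count_reverse] at hw ⊢
      refine ⟨hw.1, ?_⟩
      have := invc_reverse w
      rw [hw.1.1, hw.1.2] at this
      omega
    · exact List.reverse_injective.injOn
  omega

noncomputable def goodW (a b : ℕ) (X : ℝ) : Finset (List Bool) :=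
  (words a b).filter fun w => X ≤ 2 * (invc w : ℝ) - a * b

lemma good_ge (a b m1 m2 : ℕ) (hm : m1 + m2 = a + b) (X : ℝ) (R : Finset ℕ)
    (hR : ∀ r ∈ R, r ≤ a ∧ X ≤ r * (m1 + m2 : ℝ) - a * m1) :
    ∑ r ∈ R, m1.choose r * m2.choose (a - r) ≤ 4 * (goodW a b X).card := by
  classical
  set R' := R.filter fun r => r ≤ m1 ∧ a - r ≤ m2
  have e1 : ∑ r ∈ R, m1.choose r * m2.choose (a - r)
      = ∑ r ∈ R', m1.choose r * m2.choose (a - r) := by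
    symm
    apply Finset.sum_subset (Finset.filter_subset _ _)
    intro r hr h
    simp only [R', Finset.mem_filter, hr, true_and, not_and_or, not_le] at h
    rcases h with h | h
    · rw [Nat.choose_eq_zero_of_lt h, zero_mul]
    · rw [Nat.choose_eq_zero_of_lt h, mul_zero]
  rw [e1]
  let F : ℕ → Finset (List Bool) := fun r =>
    (halfW r (m1 - r) ×ˢ halfW (a - r) (m2 - (a - r))).image fun p => p.1 ++ p.2
  have hF : ∀ r ∈ R', ∀ w ∈ F r, ∃ u v, w = u ++ v ∧ u.length = m1 ∧ u ∈ halfW r (m1 - r) ∧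
      v ∈ halfW (a - r) (m2 - (a - r)) ∧ u.count true = r := by
    intro r hr w hw
    simp only [F, Finset.mem_image, Finset.mem_product] at hw
    obtain ⟨⟨u, v⟩, ⟨hu, hv⟩, rfl⟩ := hw
    have hu' := hu
    simp only [halfW, Finset.mem_filter, mem_words] at hu'
    simp only [R', Finset.mem_filter] at hr
    refine ⟨u, v, rfl, ?_, hu, hv, hu'.1.1⟩
    have := count_tf u
    omega
  have hcard : ∀ r ∈ R', m1.choose r * m2.choose (a - r) ≤ 4 * (F r).card := by
    intro r hr
    simp only [R', Finset.mem_filter] at hr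
    have : (F r).card = (halfW r (m1 - r)).card * (halfW (a - r) (m2 - (a - r))).card := by
      rw [← Finset.card_product]
      apply Finset.card_image_of_injOn
      rintro ⟨u, v⟩ h ⟨u', v'⟩ h' hh
      simp only [Finset.coe_product, Set.mem_prod, Finset.mem_coe, halfW, Finset.mem_filter,
        mem_words] at h h' hh
      have l1 := count_tf u
      have l2 := count_tf u'
      obtain ⟨h1, h2⟩ := List.append_inj hh (by omega)
      rw [h1, h2]
    rw [this]
    have k1 := card_halfW r (m1 - r)
    have k2 := card_halfW (a - r) (m2 - (a - r))
    rw [Nat.add_sub_cancel' hr.2.1] at k1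
    rw [Nat.add_sub_cancel' hr.2.2] at k2
    calc _ ≤ _ := Nat.mul_le_mul k1 k2
      _ = _ := by ring
  calc _ ≤ ∑ r ∈ R', 4 * (F r).card := Finset.sum_le_sum hcard
    _ = 4 * (R'.biUnion F).card := by
      rw [← Finset.mul_sum, Finset.card_biUnion]
      intro r hr r' hr' hne
      show Disjoint (F r) (F r')
      rw [Finset.disjoint_left]
      intro w hw hw'
      obtain ⟨u, v, h1, h2, _, _, h5⟩ := hF r hr w hw
      obtain ⟨u', v', h1', h2', _, _, h5'⟩ := hF r' hr' w hw'
      obtain ⟨h, _⟩ := List.append_inj (h1.symm.trans h1') (by omega)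
      apply hne; rw [← h5, ← h5', h]
    _ ≤ _ := by
      apply Nat.mul_le_mul_left
      apply Finset.card_le_card
      intro w hw
      rw [Finset.mem_biUnion] at hw
      obtain ⟨r, hr, hw⟩ := hw
      obtain ⟨u, v, rfl, h2, hu, hv, h5⟩ := hF r hr w hw
      simp only [R', Finset.mem_filter] at hr
      simp only [halfW, Finset.mem_filter, mem_words] at hu hv
      obtain ⟨hra, hX⟩ := hR r hr.1
      simp only [goodW, Finset.mem_filter, mem_words, List.count_append, invc_append]
      refine ⟨⟨by omega, by omega⟩, hX.trans ?_⟩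
      rw [hu.1.1, hv.1.2]
      have q1 : ((r * (m1 - r) : ℕ) : ℝ) ≤ ((2 * invc u : ℕ) : ℝ) := by exact_mod_cast hu.2
      have q2 : (((a - r) * (m2 - (a - r)) : ℕ) : ℝ) ≤ ((2 * invc v : ℕ) : ℝ) := by
        exact_mod_cast hv.2
      push_cast [Nat.cast_sub hr.2.1, Nat.cast_sub hr.2.2, Nat.cast_sub hra] at q1 q2 ⊢
      have hb : (b : ℝ) = m1 + m2 - a := by
        have : ((m1 + m2 : ℕ) : ℝ) = ((a + b : ℕ) : ℝ) := by rw [hm]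
        push_cast at this; linarith
      rw [hb]
      nlinarith

lemma choose_swap (m1 m2 i j : ℕ) (h : m1 = m2 ∨ m1 = m2 + 1) (hij : i ≤ j) :
    m1.choose i * m2.choose j ≤ m1.choose j * m2.choose i := by
  rcases h with rfl | rfl
  · rw [mul_comm]
  · have h1 := Nat.choose_mul_succ_eq m2 i
    have h2 := Nat.choose_mul_succ_eq m2 j
    apply Nat.le_of_mul_le_mul_right (c := m2 + 1) _ (Nat.succ_pos _)
    rw [mul_assoc, mul_assoc, h1, h2]
    have : m2 + 1 - j ≤ m2 + 1 - i := by omega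
    calc _ = (m2 + 1).choose i * (m2 + 1).choose j * (m2 + 1 - j) := by ring
      _ ≤ (m2 + 1).choose i * (m2 + 1).choose j * (m2 + 1 - i) := Nat.mul_le_mul_left _ this
      _ = _ := by ring

lemma half_sum (a m1 m2 : ℕ) (h : m1 = m2 ∨ m1 = m2 + 1) :
    (m1 + m2).choose a ≤
      2 * ∑ r ∈ (Finset.range (a + 1)).filter (fun r => a ≤ 2 * r),
        m1.choose r * m2.choose (a - r) := by
  rw [Nat.add_choose_eq, Finset.Nat.sum_antidiagonal_eq_sum_range_succ
    (fun i j => m1.choose i * m2.choose j), Nat.succ_eq_add_one,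
    ← Finset.sum_filter_add_sum_filter_not _ (fun r => a ≤ 2 * r)]
  have : ∑ r ∈ (Finset.range (a + 1)).filter (fun r => ¬ a ≤ 2 * r),
      m1.choose r * m2.choose (a - r) ≤
      ∑ r ∈ (Finset.range (a + 1)).filter (fun r => a ≤ 2 * r),
        m1.choose r * m2.choose (a - r) := by
    calc _ ≤ ∑ r ∈ (Finset.range (a + 1)).filter (fun r => ¬ a ≤ 2 * r),
          m1.choose (a - r) * m2.choose (a - (a - r)) := by
          apply Finset.sum_le_sum
          intro r hr
          simp only [Finset.mem_filter, Finset.mem_range] at hr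
          rw [show a - (a - r) = r by omega]
          exact choose_swap _ _ _ _ h (by omega)
      _ = ∑ r ∈ ((Finset.range (a + 1)).filter (fun r => ¬ a ≤ 2 * r)).image (fun r => a - r),
          m1.choose r * m2.choose (a - r) := by
          rw [Finset.sum_image]
          intro r hr s hs hh
          simp only [Finset.coe_filter, Finset.mem_range, Set.mem_ofPred_eq] at hr hs hh
          omega
      _ ≤ _ := by
          apply Finset.sum_le_sum_of_subset
          intro r hr
          simp only [Finset.mem_filter, Finset.mem_image, Finset.mem_range] at hr ⊢
          omega
  omega

lemma ratio_step (a b m1 m2 L r : ℕ) (M : ℝ) (hm : m1 + m2 = a + b) (h : m1 = m2 ∨ m1 = m2 + 1)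
    (hL : 1 ≤ L) (hMa : M ≤ a) (hMb : M ≤ b) (hLM : 80 * (L : ℝ) ≤ M)
    (hr1 : a ≤ 2 * r) (hr2 : 2 * r ≤ a + 4 * L) :
    (1 - 40 * L / M) * ((m1.choose r : ℝ) * m2.choose (a - r)) ≤
      (m1.choose (r + 1) : ℝ) * m2.choose (a - (r + 1)) := by
  have hL' : (1 : ℝ) ≤ L := by exact_mod_cast hL
  have ha : 80 * L ≤ a := by
    have : (80 : ℝ) * L ≤ a := hLM.trans hMa
    exact_mod_cast this
  have hb : 80 * L ≤ b := by
    have : (80 : ℝ) * L ≤ b := hLM.trans hMb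
    exact_mod_cast this
  have e1 : (m1.choose (r + 1) : ℝ) * (r + 1) = m1.choose r * (m1 - r) := by
    have := Nat.choose_succ_right_eq m1 r
    have h2 : ((m1.choose (r + 1) * (r + 1) : ℕ) : ℝ) = ((m1.choose r * (m1 - r) : ℕ) : ℝ) := by
      rw [this]
    push_cast [Nat.cast_sub (show r ≤ m1 by omega)] at h2
    exact h2
  have e2 : (m2.choose (a - r) : ℝ) * (a - r) = m2.choose (a - (r + 1)) * (m2 - a + r + 1) := by
    have := Nat.choose_succ_right_eq m2 (a - (r + 1))
    rw [show a - (r + 1) + 1 = a - r by omega] at this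
    have h2 : ((m2.choose (a - r) * (a - r) : ℕ) : ℝ) =
      ((m2.choose (a - (r + 1)) * (m2 - (a - (r + 1))) : ℕ) : ℝ) := by
      rw [this]
    push_cast [Nat.cast_sub (show a - (r + 1) ≤ m2 by omega), Nat.cast_sub (show r + 1 ≤ a by omega),
      Nat.cast_sub (show r ≤ a by omega)] at h2
    rw [h2]; ring
  have hmR : (m1 : ℝ) + m2 = a + b := by exact_mod_cast hm
  have hm1 : (m2 : ℝ) ≤ m1 := by
    have : m2 ≤ m1 := by omega
    exact_mod_cast this
  have hr1' : (a : ℝ) ≤ 2 * r := by exact_mod_cast hr1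
  have hr2' : (2 : ℝ) * r ≤ a + 4 * L := by exact_mod_cast hr2
  have hM : 0 < M := by linarith
  set P := (m1.choose r : ℝ) with hP
  set Q := (m2.choose (a - r) : ℝ) with hQ
  set P' := (m1.choose (r + 1) : ℝ) with hP'
  set Q' := (m2.choose (a - (r + 1)) : ℝ) with hQ'
  have hP0 : 0 ≤ P := Nat.cast_nonneg _
  have hQ0 : 0 ≤ Q := Nat.cast_nonneg _
  set U : ℝ := r + 1 with hU
  set V : ℝ := m2 - a + r + 1 with hV
  set k : ℝ := 20 * L / M with hk
  have hkM : k * M = 20 * L := by rw [hk]; field_simp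
  have hk0 : 0 ≤ k := by positivity
  have hk1 : k ≤ 1 / 4 := by
    rw [hk, div_le_iff₀ hM]; linarith
  have hm2lo : (a + b : ℝ) ≤ 2 * m2 + 1 := by
    have : a + b ≤ 2 * m2 + 1 := by omega
    exact_mod_cast this
  have hUp : 0 < U := by positivity
  have hVp : 0 < V := by rw [hV]; linarith
  have k1 : (1 - k) * U ≤ a - r := by
    have : k * M ≤ 2 * (k * U) := by
      have := mul_le_mul_of_nonneg_left (show M ≤ 2 * U by rw [hU]; linarith) hk0
      linarith
    rw [hkM] at this
    have : (1 - k) * U = U - k * U := by ring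
    rw [this, hU] at *
    linarith
  have k2 : (1 - k) * V ≤ m1 - r := by
    have : k * M ≤ 2 * (k * V) + k := by
      have := mul_le_mul_of_nonneg_left (show M ≤ 2 * V + 1 by rw [hV]; linarith) hk0
      linarith
    rw [hkM] at this
    have e : (1 - k) * V = V - k * V := by ring
    rw [e]
    have : V = m2 - a + r + 1 := hV
    linarith
  have k3 : (1 - 40 * L / M) * (U * V) ≤ (a - r) * (m1 - r) := by
    have : (40 : ℝ) * L / M = 2 * k := by rw [hk]; ring
    rw [this]
    calc (1 - 2 * k) * (U * V) ≤ ((1 - k) * U) * ((1 - k) * V) := by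
          have : 0 ≤ k ^ 2 * (U * V) := by positivity
          nlinarith
      _ ≤ _ := mul_le_mul k1 k2 (mul_nonneg (by linarith) hVp.le)
          (by linarith)
  have k4 : P' * Q' * (U * V) = P * Q * ((a - r) * (m1 - r)) := by
    calc _ = (P' * U) * (Q' * V) := by ring
      _ = _ := by rw [e1, ← e2]; ring
  apply le_of_mul_le_mul_right _ (mul_pos hUp hVp)
  rw [k4]
  calc _ = P * Q * ((1 - 40 * L / M) * (U * V)) := by ring
    _ ≤ _ := mul_le_mul_of_nonneg_left k3 (by positivity)

lemma tail_sum (a b m1 m2 L : ℕ) (M : ℝ) (hm : m1 + m2 = a + b) (h : m1 = m2 ∨ m1 = m2 + 1)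
    (hL : 1 ≤ L) (hMa : M ≤ a) (hMb : M ≤ b) (hLM : 80 * (L : ℝ) ≤ M) :
    (1 - 40 * L / M) ^ L * ((a + b).choose a : ℝ) ≤
      4 * ((∑ r ∈ (Finset.range (a + 1)).filter (fun r => a + 2 * L ≤ 2 * r),
        m1.choose r * m2.choose (a - r) : ℕ) : ℝ) := by
  have hL' : (1 : ℝ) ≤ L := by exact_mod_cast hL
  have hM : 0 < M := by linarith
  have ha : 80 * L ≤ a := by
    have : (80 : ℝ) * L ≤ a := hLM.trans hMa
    exact_mod_cast this
  set q : ℝ := 1 - 40 * L / M with hq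
  have hq0 : 0 ≤ q := by
    have : 40 * L / M ≤ 1 := by rw [div_le_iff₀ hM]; linarith
    linarith
  have hq1 : q ≤ 1 := by
    have : 0 ≤ 40 * L / M := by positivity
    linarith
  have hqL : q ^ L ≤ 1 := pow_le_one₀ hq0 hq1
  have hqL0 : 0 ≤ q ^ L := pow_nonneg hq0 _
  set p : ℕ → ℝ := fun r => (m1.choose r : ℝ) * m2.choose (a - r) with hp
  have hp0 : ∀ r, 0 ≤ p r := fun r => by positivity
  have shift : ∀ r, a ≤ 2 * r → 2 * r < a + 2 * L → q ^ L * p r ≤ p (r + L) := by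
    intro r h1 h2
    have : ∀ i, i ≤ L → q ^ i * p r ≤ p (r + i) := by
      intro i
      induction i with
      | zero => intro _; simp
      | succ i ih =>
        intro hi
        have e := ih (by omega)
        have := ratio_step a b m1 m2 L (r + i) M hm h hL hMa hMb hLM (by omega) (by omega)
        calc q ^ (i + 1) * p r = q * (q ^ i * p r) := by ring
          _ ≤ q * p (r + i) := mul_le_mul_of_nonneg_left e hq0
          _ ≤ _ := this
    exact this L le_rfl
  have hs := half_sum a m1 m2 h
  rw [hm] at hs
  have hs' : ((a + b).choose a : ℝ) ≤
      2 * ∑ r ∈ (Finset.range (a + 1)).filter (fun r => a ≤ 2 * r), p r := by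
    have : (((a + b).choose a : ℕ) : ℝ) ≤ ((_ : ℕ) : ℝ) := Nat.cast_le.mpr hs
    push_cast at this
    exact this
  push_cast
  set T := ∑ r ∈ (Finset.range (a + 1)).filter (fun r => a + 2 * L ≤ 2 * r), p r with hT
  have hT0 : 0 ≤ T := Finset.sum_nonneg fun r _ => hp0 r
  have key : q ^ L * ∑ r ∈ (Finset.range (a + 1)).filter (fun r => a ≤ 2 * r), p r ≤ 2 * T := by
    rw [← Finset.sum_filter_add_sum_filter_not _ (fun r => a + 2 * L ≤ 2 * r), mul_add]
    have A : ∑ r ∈ ((Finset.range (a + 1)).filter (fun r => a ≤ 2 * r)).filter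
        (fun r => a + 2 * L ≤ 2 * r), p r ≤ T := by
      apply Finset.sum_le_sum_of_subset_of_nonneg
      · intro r hr
        simp only [Finset.mem_filter] at hr ⊢
        exact ⟨hr.1.1, hr.2⟩
      · intro r _ _; exact hp0 r
    have B : q ^ L * ∑ r ∈ ((Finset.range (a + 1)).filter (fun r => a ≤ 2 * r)).filter
        (fun r => ¬ a + 2 * L ≤ 2 * r), p r ≤ T := by
      rw [Finset.mul_sum]
      calc _ ≤ ∑ r ∈ ((Finset.range (a + 1)).filter (fun r => a ≤ 2 * r)).filter
            (fun r => ¬ a + 2 * L ≤ 2 * r), p (r + L) := by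
            apply Finset.sum_le_sum
            intro r hr
            simp only [Finset.mem_filter] at hr
            exact shift r hr.1.2 (by omega)
        _ = ∑ r ∈ (((Finset.range (a + 1)).filter (fun r => a ≤ 2 * r)).filter
            (fun r => ¬ a + 2 * L ≤ 2 * r)).image (fun r => r + L), p r := by
            rw [Finset.sum_image]
            intro r _ s _ hh
            simpa using hh
        _ ≤ T := by
            apply Finset.sum_le_sum_of_subset_of_nonneg
            · intro r hr
              simp only [Finset.mem_filter, Finset.mem_image, Finset.mem_range] at hr ⊢
              omega
            · intro r _ _; exact hp0 r
    have A' := mul_le_of_le_one_left (Finset.sum_nonneg fun r _ => hp0 r : 0 ≤ ∑ r ∈ ((Finset.range (a + 1)).filter (fun r => a ≤ 2 * r)).filter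
        (fun r => a + 2 * L ≤ 2 * r), p r) hqL
    linarith
  have := mul_le_mul_of_nonneg_left hs' hqL0
  linarith

lemma exp_le_one_sub (x : ℝ) (h0 : 0 ≤ x) (h1 : x ≤ 1 / 2) : Real.exp (-(2 * x)) ≤ 1 - x := by
  rw [Real.exp_neg, inv_le_comm₀ (Real.exp_pos _) (by linarith)]
  have := Real.add_one_le_exp (2 * x)
  refine le_trans ?_ this
  rw [inv_le_iff_one_le_mul₀ (by linarith)]
  nlinarith

lemma words_bound (a b L : ℕ) (M X : ℝ)
    (hL : 1 ≤ L) (hMa : M ≤ a) (hMb : M ≤ b) (hLM : 80 * (L : ℝ) ≤ M)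
    (hX : X ≤ L * (a + b : ℝ) / 2) :
    Real.exp (-(80 * L ^ 2 / M)) * ((a + b).choose a : ℝ) ≤ 16 * ((goodW a b X).card : ℝ) := by
  have hL' : (1 : ℝ) ≤ L := by exact_mod_cast hL
  have hM : 0 < M := by linarith
  obtain ⟨m1, m2, hm, h⟩ : ∃ m1 m2, m1 + m2 = a + b ∧ (m1 = m2 ∨ m1 = m2 + 1) :=
    ⟨(a + b + 1) / 2, (a + b) / 2, by omega, by omega⟩
  have t := tail_sum a b m1 m2 L M hm h hL hMa hMb hLM
  have g := good_ge a b m1 m2 hm X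
    ((Finset.range (a + 1)).filter (fun r => a + 2 * L ≤ 2 * r)) (by
      intro r hr
      simp only [Finset.mem_filter, Finset.mem_range] at hr
      refine ⟨by omega, hX.trans ?_⟩
      have h1 : (a : ℝ) + 2 * L ≤ 2 * r := by exact_mod_cast hr.2
      have h2 : (m1 : ℝ) + m2 = a + b := by exact_mod_cast hm
      have h3 : 2 * (m1 : ℝ) ≤ a + b + 1 := by
        have : 2 * m1 ≤ a + b + 1 := by omega
        exact_mod_cast this
      rw [h2]
      have ha : (0 : ℝ) ≤ a := Nat.cast_nonneg _
      have hb : (0 : ℝ) ≤ b := Nat.cast_nonneg _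
      have i1 := mul_le_mul_of_nonneg_right h1 (add_nonneg ha hb)
      have i2 := mul_le_mul_of_nonneg_left h3 ha
      have i3 := mul_le_mul_of_nonneg_right hL' (add_nonneg ha hb)
      nlinarith)
  have g' : ((_ : ℕ) : ℝ) ≤ ((_ : ℕ) : ℝ) := Nat.cast_le.mpr g
  rw [Nat.cast_mul 4] at g'
  have e : Real.exp (-(80 * L ^ 2 / M)) ≤ (1 - 40 * L / M) ^ L := by
    have := exp_le_one_sub (40 * L / M) (by positivity) (by rw [div_le_iff₀ hM]; linarith)
    calc _ = Real.exp (-(2 * (40 * L / M))) ^ L := by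
          rw [← Real.exp_nat_mul]; congr 1; ring
      _ ≤ _ := pow_le_pow_left₀ (Real.exp_pos _).le this _
  have := mul_le_mul_of_nonneg_right e (Nat.cast_nonneg (α := ℝ) ((a + b).choose a))
  push_cast at g' t
  linarith

lemma card_paths (a b : ℕ) (x y : ℤ × ℤ) (h1 : y.1 = x.1 + a) (h2 : y.2 = x.2 - b)
    (P : (ℕ → ℤ × ℤ) → Prop) (Q : List Bool → Prop) [DecidablePred Q]
    (hPQ : ∀ w ∈ words a b, P (toPath w x) ↔ Q w) :
    Nat.card {γ : ℕ → ℤ × ℤ // IsPathBtw (a + b) x y γ ∧ P γ} = ((words a b).filter Q).card := by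
  have e : {γ : ℕ → ℤ × ℤ | IsPathBtw (a + b) x y γ ∧ P γ} =
      (fun w => toPath w x) '' (((words a b).filter Q : Finset (List Bool)) : Set (List Bool)) := by
    ext γ
    simp only [Set.mem_ofPred_eq, Set.mem_image, Finset.mem_coe, Finset.mem_filter]
    constructor
    · rintro ⟨⟨hγ, h0, hn⟩, hP⟩
      obtain ⟨w, hw, hg⟩ := exists_word _ _ hγ
      rw [h0] at hg
      have hend := toPath_ge w x (a + b) hw.le
      rw [← hg, hn] at hend
      have c := count_tf w
      have hmem : w ∈ words a b := by
        rw [mem_words]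
        simp only [endpt, Prod.ext_iff] at hend
        omega
      exact ⟨w, ⟨hmem, (hPQ w hmem).1 (hg ▸ hP)⟩, hg.symm⟩
    · rintro ⟨w, ⟨hmem, hQ⟩, rfl⟩
      refine ⟨?_, (hPQ w hmem).2 hQ⟩
      rw [mem_words] at hmem
      have c := count_tf w
      have hl : w.length = a + b := by omega
      refine ⟨⟨fun k hk => toPath_step w x k (by omega), fun k hk => ?_⟩, toPath_zero w x, ?_⟩
      · rw [toPath_ge w x k (by omega), toPath_ge w x (a + b) (by omega)]
      · rw [toPath_ge w x (a + b) (by omega), endpt, hmem.1, hmem.2, ← h1, ← h2]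
  have : Nat.card {γ : ℕ → ℤ × ℤ // IsPathBtw (a + b) x y γ ∧ P γ} =
    Set.ncard {γ : ℕ → ℤ × ℤ | IsPathBtw (a + b) x y γ ∧ P γ} := rfl
  rw [this, e, Set.ncard_image_of_injOn, Set.ncard_coe_finset]
  intro w hw w' hw' hh
  simp only [Finset.coe_filter, Set.mem_ofPred_eq, mem_words] at hw hw'
  have c := count_tf w
  have c' := count_tf w'
  exact toPath_inj w w' x (by omega) hh

lemma card_all (a b : ℕ) (x y : ℤ × ℤ) (h1 : y.1 = x.1 + a) (h2 : y.2 = x.2 - b) :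
    Nat.card {γ : ℕ → ℤ × ℤ // IsPathBtw (a + b) x y γ} = (a + b).choose a := by
  have := card_paths a b x y h1 h2 (fun _ => True) (fun _ => True) (by simp)
  simp only [and_true] at this
  rw [this, Finset.filter_true, card_words]

lemma card_good (a b : ℕ) (x y : ℤ × ℤ) (h1 : y.1 = x.1 + a) (h2 : y.2 = x.2 - b) (Y : ℝ) :
    Nat.card {γ : ℕ → ℤ × ℤ // IsPathBtw (a + b) x y γ ∧ Y ≤ (excessArea2 (a + b) γ : ℝ) / 2}
      = (goodW a b (2 * Y)).card := by
  classical
  rw [card_paths a b x y h1 h2 (fun γ => Y ≤ (excessArea2 (a + b) γ : ℝ) / 2)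
    (fun w => 2 * Y ≤ 2 * (invc w : ℝ) - a * b)]
  · rw [goodW]
  · intro w hw
    rw [mem_words] at hw
    have c := count_tf w
    have := excess_word w x
    rw [hw.1, hw.2, ← c, hw.1, hw.2] at this
    rw [this]
    push_cast
    constructor <;> intro h <;> linarith

lemma eventually_conds (τ η : ℝ) (hτ : 0 < τ) (hη : 0 < η) : ∃ N₀ : ℝ, ∀ h : ℝ, N₀ ≤ h →
    1 < h ∧ 1 ≤ η * Real.sqrt (h * Real.log h) ∧
    400 * (η * Real.sqrt (h * Real.log h)) ≤ τ * h / 2 ∧ 16 ≤ h ^ (η ^ 2) := by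
  have A : ∀ᶠ h : ℝ in Filter.atTop, 1 < h := Filter.eventually_gt_atTop 1
  have B : ∀ᶠ h : ℝ in Filter.atTop, 16 ≤ h ^ (η ^ 2) :=
    (tendsto_rpow_atTop (by positivity)).eventually_ge_atTop 16
  have D : ∀ᶠ h : ℝ in Filter.atTop, (1 / η) ^ 2 ≤ h := Filter.eventually_ge_atTop _
  have E : ∀ᶠ h : ℝ in Filter.atTop, 1 ≤ Real.log h :=
    Real.tendsto_log_atTop.eventually_ge_atTop 1
  have F : ∀ᶠ h : ℝ in Filter.atTop, ‖Real.log h‖ ≤ (τ / (800 * η)) ^ 2 * ‖h‖ :=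
    Real.isLittleO_log_id_atTop.bound (by positivity)
  obtain ⟨N, hN⟩ := Filter.eventually_atTop.1 (A.and (B.and (D.and (E.and F))))
  refine ⟨N, fun h hh => ?_⟩
  obtain ⟨h1, h2, h3, h4, h5⟩ := hN h hh
  refine ⟨h1, ?_, ?_, h2⟩
  · have : 1 / η ≤ Real.sqrt (h * Real.log h) := by
      apply Real.le_sqrt_of_sq_le
      nlinarith
    rw [div_le_iff₀ hη] at this
    linarith
  · rw [Real.norm_of_nonneg (by linarith), Real.norm_of_nonneg (by linarith)] at h5
    have : Real.sqrt (h * Real.log h) ≤ τ / (800 * η) * h := by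
      apply Real.sqrt_le_iff.2
      constructor
      · positivity
      · calc _ ≤ h * ((τ / (800 * η)) ^ 2 * h) := mul_le_mul_of_nonneg_left h5 (by linarith)
          _ = _ := by ring
    calc _ ≤ 400 * (η * (τ / (800 * η) * h)) := by gcongr
      _ = _ := by field_simp; norm_num

/-- Polynomial lower bound for logarithmic good area capture: for chord angles in
`[ε, π/2 − ε]` there is `C = C(ε) > 0` such that for any `η > 0` and
`h = ‖x − y‖ ≥ N₀(ε, η)`, the proportion of down-right paths from `x` to `y` whose area
exceeds the triangle `0xy` by at least `η h^{3/2} (log h)^{1/2}` is at least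
`h^{−Cη²}`. -/
theorem stmt19 (ε : ℝ) (hε0 : 0 < ε) (hε : ε < Real.pi / 4) :
    ∃ C : ℝ, 0 < C ∧ ∀ η : ℝ, 0 < η → ∃ N₀ : ℝ, ∀ x y : ℤ × ℤ,
      0 ≤ x.1 → 0 ≤ y.2 → x.1 ≤ y.1 → y.2 ≤ x.2 →
      ε ≤ Real.arctan (((x.2 - y.2 : ℤ) : ℝ) / ((y.1 - x.1 : ℤ) : ℝ)) →
      Real.arctan (((x.2 - y.2 : ℤ) : ℝ) / ((y.1 - x.1 : ℤ) : ℝ)) ≤ Real.pi / 2 - ε →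
      N₀ ≤ Real.sqrt (((y.1 - x.1 : ℤ) : ℝ) ^ 2 + ((x.2 - y.2 : ℤ) : ℝ) ^ 2) →
      (Real.sqrt (((y.1 - x.1 : ℤ) : ℝ) ^ 2 + ((x.2 - y.2 : ℤ) : ℝ) ^ 2))
          ^ (-(C * η ^ 2)) *
        (Nat.card {γ : ℕ → ℤ × ℤ //
            IsPathBtw ((y.1 - x.1) + (x.2 - y.2)).toNat x y γ} : ℝ)
        ≤ (Nat.card {γ : ℕ → ℤ × ℤ //
            IsPathBtw ((y.1 - x.1) + (x.2 - y.2)).toNat x y γ ∧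
            η * (Real.sqrt (((y.1 - x.1 : ℤ) : ℝ) ^ 2 + ((x.2 - y.2 : ℤ) : ℝ) ^ 2))
                ^ ((3 : ℝ) / 2) *
              Real.sqrt (Real.log
                (Real.sqrt (((y.1 - x.1 : ℤ) : ℝ) ^ 2 + ((x.2 - y.2 : ℤ) : ℝ) ^ 2)))
              ≤ (excessArea2 ((y.1 - x.1) + (x.2 - y.2)).toNat γ : ℝ) / 2} : ℝ) := by
  have hτ : 0 < Real.tan ε := Real.tan_pos_of_pos_of_lt_pi_div_two hε0 (by linarith [Real.pi_pos])
  have hτ1 : Real.tan ε ≤ 1 := by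
    rw [← Real.tan_pi_div_four]
    exact (Real.tan_lt_tan_of_nonneg_of_lt_pi_div_two hε0.le (by linarith [Real.pi_pos]) hε).le
  obtain ⟨τ, hτe⟩ : ∃ τ, τ = Real.tan ε := ⟨_, rfl⟩
  rw [← hτe] at hτ hτ1
  refine ⟨4000 / τ + 1, by positivity, fun η hη => ?_⟩
  obtain ⟨N₀, hN⟩ := eventually_conds τ η hτ hη
  refine ⟨N₀, fun x y _ _ hx hy ht1 ht2 hh => ?_⟩
  obtain ⟨a, ha⟩ := Int.eq_ofNat_of_zero_le (sub_nonneg.2 hx)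
  obtain ⟨b, hb⟩ := Int.eq_ofNat_of_zero_le (sub_nonneg.2 hy)
  rw [ha, hb] at ht1 ht2
  rw [ha, hb] at hh ⊢
  have hn : ((a : ℤ) + (b : ℤ)).toNat = a + b := by omega
  rw [hn]
  rw [card_all a b x y (by omega) (by omega), card_good a b x y (by omega) (by omega)]
  simp only [Int.cast_natCast] at ht1 ht2 hh ⊢
  obtain ⟨h, hh'⟩ : ∃ h, h = Real.sqrt ((a : ℝ) ^ 2 + (b : ℝ) ^ 2) := ⟨_, rfl⟩
  rw [← hh'] at hh ⊢
  obtain ⟨c1, c2, c3, c4⟩ := hN h hh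
  have hb0 : (0 : ℝ) ≤ b := Nat.cast_nonneg _
  have ha0 : (0 : ℝ) < a := by
    rcases (Nat.cast_nonneg (α := ℝ) a).eq_or_lt with h0 | h0
    · rw [← h0] at ht1
      simp at ht1
      linarith
    · exact h0
  have q1 : τ * a ≤ b := by
    have : τ ≤ b / a := by
      rw [hτe, ← Real.tan_arctan ((b : ℝ) / a)]
      exact Real.strictMonoOn_tan.monotoneOn ⟨by linarith, by linarith⟩
        ⟨Real.neg_pi_div_two_lt_arctan _, Real.arctan_lt_pi_div_two _⟩ ht1
    rwa [le_div_iff₀ ha0] at this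
  have q2 : τ * b ≤ a := by
    have : (b : ℝ) / a ≤ τ⁻¹ := by
      rw [hτe, ← Real.tan_pi_div_two_sub, ← Real.tan_arctan ((b : ℝ) / a)]
      exact Real.strictMonoOn_tan.monotoneOn 
        ⟨Real.neg_pi_div_two_lt_arctan _, Real.arctan_lt_pi_div_two _⟩
        ⟨by linarith, by linarith⟩ ht2
    rw [div_le_iff₀ ha0, inv_mul_eq_div, le_div_iff₀ hτ] at this
    linarith
  have hab : h ≤ a + b := by
    rw [hh']
    apply Real.sqrt_le_iff.2
    constructor
    · positivity
    · nlinarith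
  have hMa : τ * h / 2 ≤ a := by nlinarith
  have hMb : τ * h / 2 ≤ b := by nlinarith
  obtain ⟨g, hg⟩ : ∃ g, g = η * Real.sqrt (h * Real.log h) := ⟨_, rfl⟩
  rw [← hg] at c2 c3
  have hlog : 0 < Real.log h := Real.log_pos c1
  have h0 : 0 < h := by linarith
  have hg2 : g ^ 2 = η ^ 2 * (h * Real.log h) := by
    rw [hg, mul_pow, Real.sq_sqrt (by positivity)]
  have hL1 := Nat.le_ceil (4 * g)
  have hL2 := Nat.ceil_lt_add_one (show 0 ≤ 4 * g by linarith)
  obtain ⟨L, hL⟩ : ∃ L, L = ⌈4 * g⌉₊ := ⟨_, rfl⟩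
  rw [← hL] at hL1 hL2
  have hLg : (L : ℝ) ≤ 5 * g := by linarith
  have hX : η * h ^ ((3 : ℝ) / 2) * Real.sqrt (Real.log h) = g * h := by
    rw [hg, Real.sqrt_mul h0.le, Real.sqrt_eq_rpow h,
      show (3 : ℝ) / 2 = 1 / 2 + 1 by norm_num, Real.rpow_add h0, Real.rpow_one]
    ring
  have wb := words_bound a b L (τ * h / 2) (2 * (g * h))
    (by have : (1 : ℝ) ≤ L := by linarith
        exact_mod_cast this) hMa hMb (by linarith)
    (by have := mul_le_mul hL1 hab h0.le (by positivity)
        linarith)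
  rw [hX]
  have e1 : h ^ (-(4000 / τ * η ^ 2)) ≤ Real.exp (-(80 * (L : ℝ) ^ 2 / (τ * h / 2))) := by
    rw [Real.rpow_def_of_pos h0]
    apply Real.exp_le_exp.2
    rw [mul_neg, neg_le_neg_iff, div_le_iff₀ (by positivity)]
    have : (L : ℝ) ^ 2 ≤ 25 * (η ^ 2 * (h * Real.log h)) := by
      rw [← hg2]
      nlinarith [Nat.cast_nonneg (α := ℝ) L]
    calc _ ≤ 80 * (25 * (η ^ 2 * (h * Real.log h))) := by linarith
      _ = _ := by field_simp; norm_num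
  have e2 : h ^ (-((4000 / τ + 1) * η ^ 2)) * 16 ≤ h ^ (-(4000 / τ * η ^ 2)) := by
    calc _ ≤ h ^ (-((4000 / τ + 1) * η ^ 2)) * h ^ (η ^ 2) :=
          mul_le_mul_of_nonneg_left c4 (by positivity)
      _ = _ := by rw [← Real.rpow_add h0]; congr 1; ring
  have e3 := mul_le_mul_of_nonneg_right (e2.trans e1) (Nat.cast_nonneg (α := ℝ) ((a + b).choose a))
  linarith
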